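/- arXiv:2307.10552 — 3 statements merged into one kernel-verified Lean document; each statement's English description precedes it below -/
import Mathlib

section
/- Under the sentinel assumptions, for any nonempty MCS-prefix Z' and any Z'-extensible character c, the first component i_{safe(Z'∘c)} of safe(Z'∘c) equals the minimum of the following at most three values: (a) |X|+1; (b) the minimum of next_X(c, next_X(Y[j], i_{pref(Z')})) over all indices j with j_{pref(Z')} < j < j_{pref(Z'∘c)} such that next_X(Y[j], i_{pref(Z')}) ≤ |X|, if any such j exists; (c) next_X(c, i_{safe(Z')}), if i_{safe(Z')} ≤ |X|. The second component j_{safe(Z'∘c)} is given by the symmetric formula obtained by exchanging the roles of X and Y (and of the two components). -/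
open scoped Classical

namespace MCSPaper

variable {α : Type*}

/-- `Z` is a common subsequence of `X` and `Y` (i.e. `X` and `Y` share `Z`). -/
def Shares (X Y Z : List α) : Prop := Z.Sublist X ∧ Z.Sublist Y

/-- `Z` is a maximal common subsequence of `X` and `Y`: it is a common
subsequence and no single-character insertion yields a common subsequence. -/
def IsMCS (X Y Z : List α) : Prop :=
  Shares X Y Z ∧
    ∀ k, k ≤ Z.length → ∀ c : α, ¬ Shares X Y (Z.take k ++ c :: Z.drop k)

/-- `w = (i, j)` is a match: `1 ≤ i ≤ |X|`, `1 ≤ j ≤ |Y|`, `X[i] = Y[j]`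
(1-based indexing). -/
def IsMatch (X Y : List α) (w : ℕ × ℕ) : Prop :=
  1 ≤ w.1 ∧ w.1 ≤ X.length ∧ 1 ≤ w.2 ∧ w.2 ≤ Y.length ∧
    ∃ c : α, X[w.1 - 1]? = some c ∧ Y[w.2 - 1]? = some c

/-- `c_w = c`, i.e. `X[i_w] = Y[j_w] = c` (1-based indexing). -/
def MatchChar (X Y : List α) (w : ℕ × ℕ) (c : α) : Prop :=
  X[w.1 - 1]? = some c ∧ Y[w.2 - 1]? = some c

/-- `pref(Z)`: componentwise least 1-based indices `(i, j)` such that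
`X[1..i]` and `Y[1..j]` contain `Z` as a subsequence; `pref(ε) = (0,0)`. -/
noncomputable def prefPair (X Y Z : List α) : ℕ × ℕ :=
  (sInf {i | Z.Sublist (X.take i)}, sInf {j | Z.Sublist (Y.take j)})

/-- `suff(Z)`: componentwise greatest 1-based indices `(i, j)` such that
`X[i..|X|]` and `Y[j..|Y|]` contain `Z` as a subsequence;
`suff(ε) = (|X|+1, |Y|+1)`. -/
noncomputable def suffPair (X Y Z : List α) : ℕ × ℕ :=
  (sSup {i | i ≤ X.length + 1 ∧ Z.Sublist (X.drop (i - 1))},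
   sSup {j | j ≤ Y.length + 1 ∧ Z.Sublist (Y.drop (j - 1))})

/-- `u < v` componentwise strictly. -/
def pLt (u v : ℕ × ℕ) : Prop := u.1 < v.1 ∧ u.2 < v.2

/-- `u ≤ v` componentwise. -/
def pLe (u v : ℕ × ℕ) : Prop := u.1 ≤ v.1 ∧ u.2 ≤ v.2

/-- `u ⪇ v`: `u ≤ v` componentwise and `u ≠ v`. -/
def pLneq (u v : ℕ × ℕ) : Prop := pLe u v ∧ u ≠ v

/-- `u ≺ v`: `u < v` and there is no match `w` with `u < w < v`. -/
def pPrec (X Y : List α) (u v : ℕ × ℕ) : Prop :=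
  pLt u v ∧ ¬ ∃ w, IsMatch X Y w ∧ pLt u w ∧ pLt w v

/-- `w` is a suff-match: `w = suff(Z)` for some nonempty shared `Z`. -/
def IsSuffMatch (X Y : List α) (w : ℕ × ℕ) : Prop :=
  ∃ Z : List α, Z ≠ [] ∧ Shares X Y Z ∧ suffPair X Y Z = w

/-- `w` is a pref-match: `w = pref(Z)` for some nonempty shared `Z`. -/
def IsPrefMatch (X Y : List α) (w : ℕ × ℕ) : Prop :=
  ∃ Z : List α, Z ≠ [] ∧ Shares X Y Z ∧ prefPair X Y Z = w

/-- `next_W(c, h)`: least `h'` with `h < h' ≤ |W|` and `W[h'] = c`,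
or `|W| + 1` if none (1-based). -/
noncomputable def nextIdx (W : List α) (c : α) (h : ℕ) : ℕ :=
  sInf ({h' | h < h' ∧ W[h' - 1]? = some c} ∪ {W.length + 1})

/-- `prev_W(c, h)`: greatest `h'` with `1 ≤ h' < h` and `W[h'] = c`,
or `0` if none (1-based). -/
noncomputable def prevIdx (W : List α) (c : α) (h : ℕ) : ℕ :=
  sSup {h' | 1 ≤ h' ∧ h' < h ∧ W[h' - 1]? = some c}

/-- `next(c, w) = (next_X(c, i_w), next_Y(c, j_w))`. -/
noncomputable def nextPair (X Y : List α) (c : α) (w : ℕ × ℕ) : ℕ × ℕ :=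
  (nextIdx X c w.1, nextIdx Y c w.2)

/-- `prev(c, w) = (prev_X(c, i_w), prev_Y(c, j_w))`. -/
noncomputable def prevPair (X Y : List α) (c : α) (w : ℕ × ℕ) : ℕ × ℕ :=
  (prevIdx X c w.1, prevIdx Y c w.2)

/-- `Z'` is a prefix of some MCS of `X` and `Y`. -/
def IsMCSPrefix (X Y Z' : List α) : Prop :=
  ∃ M, IsMCS X Y M ∧ Z' <+: M

/-- `c` is `Z'`-extensible: `Z' ∘ c` is an MCS-prefix. -/
def Extensible (X Y Z' : List α) (c : α) : Prop :=
  IsMCSPrefix X Y (Z' ++ [c])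

/-- `Zs` is a single-character insertion derivative of `Z` (shared by `X`, `Y`). -/
def IsDeriv (X Y Z Zs : List α) : Prop :=
  ∃ k, k ≤ Z.length ∧ ∃ c : α, Zs = Z.take k ++ c :: Z.drop k ∧ Shares X Y Zs

/-- `safe(Z')` as in Conte et al. -/
noncomputable def safePair (X Y Z' : List α) : ℕ × ℕ :=
  (sInf ({i | ∃ Zs, IsDeriv X Y Z' Zs ∧
      prefPair X Y Zs = (i, (prefPair X Y Z').2)} ∪ {X.length + 1}),
   sInf ({j | ∃ Zs, IsDeriv X Y Z' Zs ∧
      prefPair X Y Zs = ((prefPair X Y Z').1, j)} ∪ {Y.length + 1}))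

/-- `v` is a `c`-witness of `Z'`-extensibility. -/
def IsCWitness (X Y Z' : List α) (c : α) (v : ℕ × ℕ) : Prop :=
  IsSuffMatch X Y v ∧ pPrec X Y (prefPair X Y Z') v ∧
    pLe v (safePair X Y Z') ∧ MatchChar X Y v c

/-- `v` is a witness of `Z'`-extensibility. -/
def IsWitness (X Y Z' : List α) (v : ℕ × ℕ) : Prop :=
  ∃ c, IsCWitness X Y Z' c v

/-- `v` is a prominent witness of `Z'`-extensibility. -/
def Prominent (X Y Z' : List α) (v : ℕ × ℕ) : Prop :=
  IsWitness X Y Z' v ∧ ¬ ∃ v', IsWitness X Y Z' v' ∧ pLneq v' v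

/-- `Suff_i[j]`: least `i'` with `i ≤ i' ≤ |X|` such that `(i', j)` is a
suff-match, or `|X| + 1` if none. -/
noncomputable def SuffSeq (X Y : List α) (i j : ℕ) : ℕ :=
  sInf ({i' | i ≤ i' ∧ i' ≤ X.length ∧ IsSuffMatch X Y (i', j)} ∪ {X.length + 1})

/-- `î`: number of indices `i'` with `1 ≤ i' ≤ i` and `X[i'] = c`. -/
def hatI [DecidableEq α] (X : List α) (c : α) (i : ℕ) : ℕ :=
  (X.take i).count c

/-- `ĵ`: number of indices `j'` with `1 ≤ j' ≤ j` and `Y[j'] = c`. -/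
def hatJ [DecidableEq α] (Y : List α) (c : α) (j : ℕ) : ℕ :=
  (Y.take j).count c

/-- Sentinel assumptions: `Σ = {1, …, σ}`, `X[1] = Y[1] = 1`,
`X[|X|] = Y[|Y|] = σ`, and the inner characters lie in `{2, …, σ−1}`. -/
def Sentinel (X Y : List ℕ) (σ : ℕ) : Prop :=
  X ≠ [] ∧ Y ≠ [] ∧ X.head? = some 1 ∧ Y.head? = some 1 ∧
    X.getLast? = some σ ∧ Y.getLast? = some σ ∧
    (∀ c ∈ (X.drop 1).dropLast, 2 ≤ c ∧ c ≤ σ - 1) ∧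
    (∀ c ∈ (Y.drop 1).dropLast, 2 ≤ c ∧ c ≤ σ - 1)

/-- The length of the shortest prefix of `W` containing `Z` as a subsequence. -/
noncomputable def prefLen (W Z : List α) : ℕ := sInf {i | Z.Sublist (W.take i)}

theorem sublist_take_iff_prefLen_le {W Z : List α} (h : Z.Sublist W) (i : ℕ) :
    Z.Sublist (W.take i) ↔ prefLen W Z ≤ i := by
  constructor
  · exact fun hi => Nat.sInf_le hi
  · intro hi
    have hne : {i | Z.Sublist (W.take i)}.Nonempty := ⟨W.length, by simpa using h⟩
    exact (Nat.sInf_mem hne).trans (List.take_sublist_take_left hi)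

theorem prefLen_le_length {W Z : List α} (h : Z.Sublist W) : prefLen W Z ≤ W.length :=
  (sublist_take_iff_prefLen_le h _).1 (by simpa using h)

theorem prefLen_mono {W Z T : List α} (hZT : Z.Sublist T) (hT : T.Sublist W) :
    prefLen W Z ≤ prefLen W T :=
  (sublist_take_iff_prefLen_le (hZT.trans hT) _).1
    (hZT.trans ((sublist_take_iff_prefLen_le hT _).2 le_rfl))

theorem append_sublist_iff_drop_prefLen {W Z : List α} (R : List α) (h : Z.Sublist W) :
    (Z ++ R).Sublist W ↔ R.Sublist (W.drop (prefLen W Z)) := by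
  constructor
  · intro hR
    obtain ⟨r₁, r₂, hW, h₁, h₂⟩ := List.append_sublist_iff.1 hR
    have hle : prefLen W Z ≤ r₁.length :=
      (sublist_take_iff_prefLen_le h _).1 (by simpa [hW] using h₁)
    have hr₂ : r₂ = W.drop r₁.length := by simp [hW]
    exact (hr₂ ▸ h₂).trans (List.drop_sublist_drop_left W hle)
  · intro hR
    have := ((sublist_take_iff_prefLen_le h _).2 le_rfl).append hR
    rwa [List.take_append_drop] at this

theorem nextIdx_le_iff {W : List α} {c : α} {h i : ℕ} (hi : i ≤ W.length) :
    nextIdx W c h ≤ i ↔ ∃ h', h < h' ∧ h' ≤ i ∧ W[h' - 1]? = some c := by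
  constructor
  · intro hle
    have hmem : nextIdx W c h ∈ {h' | h < h' ∧ W[h' - 1]? = some c} ∪ {W.length + 1} :=
      Nat.sInf_mem ⟨W.length + 1, Or.inr rfl⟩
    rcases hmem with ⟨h₁, h₂⟩ | heq
    · exact ⟨_, h₁, hle, h₂⟩
    · rw [Set.mem_singleton_iff] at heq
      omega
  · rintro ⟨h', hlt, hle, hc⟩
    exact (Nat.sInf_le (Or.inl ⟨hlt, hc⟩)).trans hle

theorem nextIdx_le_succ_length (W : List α) (c : α) (h : ℕ) :
    nextIdx W c h ≤ W.length + 1 :=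
  Nat.sInf_le (Or.inr rfl)

theorem nextIdx_spec {W : List α} {c : α} {h : ℕ} (hle : nextIdx W c h ≤ W.length) :
    h < nextIdx W c h ∧ W[nextIdx W c h - 1]? = some c := by
  obtain ⟨h', h₁, h₂, h₃⟩ := (nextIdx_le_iff hle).1 le_rfl
  obtain rfl : h' = nextIdx W c h := h₂.antisymm (Nat.sInf_le (Or.inl ⟨h₁, h₃⟩))
  exact ⟨h₁, h₃⟩

theorem nextIdx_mono (W : List α) (c : α) {a b : ℕ} (hab : a ≤ b) :
    nextIdx W c a ≤ nextIdx W c b := by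
  by_cases hb : nextIdx W c b ≤ W.length
  · obtain ⟨h₁, h₂⟩ := nextIdx_spec hb
    exact Nat.sInf_le (Or.inl ⟨hab.trans_lt h₁, h₂⟩)
  · have := nextIdx_le_succ_length W c a
    omega

theorem nextIdx_eq_of_le_of_lt {W : List α} {c : α} {a b : ℕ} (hab : a ≤ b)
    (hb : b < nextIdx W c a) (hle : nextIdx W c a ≤ W.length) :
    nextIdx W c b = nextIdx W c a :=
  le_antisymm (Nat.sInf_le (Or.inl ⟨hb, (nextIdx_spec hle).2⟩)) (nextIdx_mono W c hab)

theorem singleton_sublist_take_drop_iff {W : List α} {c : α} {h i : ℕ} (hi : i ≤ W.length) :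
    [c].Sublist ((W.take i).drop h) ↔ nextIdx W c h ≤ i := by
  rw [List.singleton_sublist, nextIdx_le_iff hi, List.mem_iff_getElem?]
  constructor
  · rintro ⟨n, hn⟩
    rw [List.getElem?_drop, List.getElem?_take] at hn
    split_ifs at hn with hlt
    exact ⟨h + n + 1, by omega, by omega, by simpa using hn⟩
  · rintro ⟨h', h₁, h₂, h₃⟩
    refine ⟨h' - 1 - h, ?_⟩
    rw [List.getElem?_drop, List.getElem?_take, if_pos (by omega)]
    rwa [show h + (h' - 1 - h) = h' - 1 by omega]

theorem prefLen_take {W Z : List α} {i : ℕ} (h : Z.Sublist (W.take i)) :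
    prefLen (W.take i) Z = prefLen W Z := by
  have hW := h.trans (List.take_sublist i W)
  apply le_antisymm
  · rw [← sublist_take_iff_prefLen_le h, List.take_take,
      sublist_take_iff_prefLen_le hW]
    exact le_min le_rfl ((sublist_take_iff_prefLen_le hW _).1 h)
  · have := (sublist_take_iff_prefLen_le h _).2 le_rfl
    rw [List.take_take, sublist_take_iff_prefLen_le hW] at this
    exact this.trans (min_le_left _ _)

theorem concat_sublist_take_iff {W Z : List α} {c : α} {i : ℕ} (h : Z.Sublist W)
    (hi : i ≤ W.length) :
    (Z ++ [c]).Sublist (W.take i) ↔ nextIdx W c (prefLen W Z) ≤ i := by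
  by_cases hZ : Z.Sublist (W.take i)
  · rw [append_sublist_iff_drop_prefLen _ hZ, prefLen_take hZ,
      singleton_sublist_take_drop_iff hi]
  · refine iff_of_false (fun hc => hZ ((List.sublist_append_left _ _).trans hc)) fun hle => ?_
    rw [sublist_take_iff_prefLen_le h] at hZ
    have := (nextIdx_spec (hle.trans hi)).1
    omega

theorem concat_sublist_iff {W Z : List α} {c : α} (h : Z.Sublist W) :
    (Z ++ [c]).Sublist W ↔ nextIdx W c (prefLen W Z) ≤ W.length := by
  simpa using concat_sublist_take_iff (c := c) h le_rfl

theorem prefLen_concat {W Z : List α} {c : α} (h : (Z ++ [c]).Sublist W) :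
    prefLen W (Z ++ [c]) = nextIdx W c (prefLen W Z) := by
  have hZ := (List.sublist_append_left _ _).trans h
  have hn := (concat_sublist_iff hZ).1 h
  apply le_antisymm
  · rw [← sublist_take_iff_prefLen_le h, concat_sublist_take_iff hZ hn]
  · rw [← concat_sublist_take_iff hZ (prefLen_le_length h), sublist_take_iff_prefLen_le h]

theorem csInf_le_csInf_of_forall_exists_le {A B : Set ℕ} (hB : B.Nonempty)
    (h : ∀ b ∈ B, ∃ a ∈ A, a ≤ b) : sInf A ≤ sInf B := by
  obtain ⟨a, ha, hab⟩ := h _ (Nat.sInf_mem hB)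
  exact (Nat.sInf_le ha).trans hab

theorem Shares.swap {X Y Z : List α} (h : Shares X Y Z) : Shares Y X Z := ⟨h.2, h.1⟩

theorem IsDeriv.swap {X Y Z T : List α} (h : IsDeriv X Y Z T) : IsDeriv Y X Z T := by
  obtain ⟨k, hk, c, hT, hs⟩ := h
  exact ⟨k, hk, c, hT, hs.swap⟩

theorem isDeriv_swap_iff {X Y Z T : List α} : IsDeriv X Y Z T ↔ IsDeriv Y X Z T :=
  ⟨IsDeriv.swap, IsDeriv.swap⟩

theorem IsMCSPrefix.swap {X Y Z : List α} (h : IsMCSPrefix X Y Z) : IsMCSPrefix Y X Z := by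
  obtain ⟨M, ⟨hs, hmax⟩, hZ⟩ := h
  exact ⟨M, ⟨hs.swap, fun k hk c hc => hmax k hk c hc.swap⟩, hZ⟩

theorem IsMCSPrefix.shares {X Y Z : List α} (h : IsMCSPrefix X Y Z) : Shares X Y Z := by
  obtain ⟨M, ⟨hs, -⟩, hZ⟩ := h
  exact ⟨hZ.sublist.trans hs.1, hZ.sublist.trans hs.2⟩

theorem IsDeriv.shares {X Y Z T : List α} (h : IsDeriv X Y Z T) : Shares X Y T := by
  obtain ⟨_, _, _, _, hs⟩ := h
  exact hs

theorem IsDeriv.sublist {X Y Z T : List α} (h : IsDeriv X Y Z T) : Z.Sublist T := by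
  obtain ⟨k, -, c, rfl, -⟩ := h
  conv_lhs => rw [← List.take_append_drop k Z]
  exact (List.Sublist.refl _).append (List.sublist_cons_self _ _)

/-- An insertion derivative of an MCS-prefix moves its leftmost embedding in `X` or in `Y`. -/
theorem IsDeriv.prefLen_ne {X Y Z T : List α} (h : IsDeriv X Y Z T) (hZ : IsMCSPrefix X Y Z)
    (hX : prefLen X T = prefLen X Z) : prefLen Y T ≠ prefLen Y Z := by
  intro hY
  have hZs := hZ.shares
  have hTs := h.shares
  obtain ⟨k, hk, d, rfl, -⟩ := h
  obtain ⟨M, ⟨hM, hmax⟩, R, rfl⟩ := hZ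
  refine hmax k (by simp; omega) d ?_
  rw [List.take_append_of_le_length hk, List.drop_append_of_le_length hk,
    ← List.cons_append, ← List.append_assoc]
  constructor
  · rw [append_sublist_iff_drop_prefLen _ hTs.1, hX, ← append_sublist_iff_drop_prefLen _ hZs.1]
    exact hM.1
  · rw [append_sublist_iff_drop_prefLen _ hTs.2, hY, ← append_sublist_iff_drop_prefLen _ hZs.2]
    exact hM.2

theorem IsDeriv.concat {X Y Z T : List α} {c : α} (h : IsDeriv X Y Z T)
    (hs : Shares X Y (T ++ [c])) : IsDeriv X Y (Z ++ [c]) (T ++ [c]) := by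
  obtain ⟨k, hk, d, rfl, -⟩ := h
  refine ⟨k, by simp; omega, d, ?_, hs⟩
  rw [List.take_append_of_le_length hk, List.drop_append_of_le_length hk]
  simp

/-- A derivative of `Z ∘ c` appends a character, inserts one just before `c`, or inserts one
before the last character of `Z`. -/
theorem IsDeriv.concat_cases {X Y Z T : List α} {c : α} (h : IsDeriv X Y (Z ++ [c]) T) :
    (∃ d, T = Z ++ [c] ++ [d]) ∨ (∃ d, T = Z ++ [d] ++ [c]) ∨
      ∃ S z, IsDeriv X Y Z (S ++ [z]) ∧ T = S ++ [z] ++ [c] := by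
  obtain ⟨k, hk, d, rfl, hs⟩ := h
  rw [List.length_append, List.length_singleton] at hk
  rcases Nat.lt_trichotomy k Z.length with hlt | rfl | hgt
  · refine Or.inr (Or.inr ?_)
    have hne : Z.drop k ≠ [] := by simpa using hlt
    rw [List.take_append_of_le_length hlt.le, List.drop_append_of_le_length hlt.le] at hs ⊢
    have hsplit : Z.take k ++ d :: Z.drop k =
        (Z.take k ++ d :: (Z.drop k).dropLast) ++ [(Z.drop k).getLast hne] := by
      simp only [List.append_assoc, List.cons_append, List.dropLast_append_getLast]
    have heq : Z.take k ++ d :: (Z.drop k ++ [c]) = (Z.take k ++ d :: Z.drop k) ++ [c] := by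
      simp
    refine ⟨Z.take k ++ d :: (Z.drop k).dropLast, (Z.drop k).getLast hne, ?_, ?_⟩
    · rw [heq, hsplit] at hs
      exact ⟨k, hlt.le, d, hsplit.symm, (List.sublist_append_left _ _).trans hs.1,
        (List.sublist_append_left _ _).trans hs.2⟩
    · rw [heq, hsplit]
  · exact Or.inr (Or.inl ⟨d, by simp⟩)
  · obtain rfl : k = Z.length + 1 := by omega
    exact Or.inl ⟨d, by simp [List.take_of_length_le, List.drop_of_length_le]⟩

theorem prefPair_eq (X Y Z : List α) : prefPair X Y Z = (prefLen X Z, prefLen Y Z) := rfl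

theorem prefPair_swap (X Y Z : List α) : prefPair Y X Z = (prefPair X Y Z).swap := rfl

theorem safePair_swap (X Y Z : List α) : safePair Y X Z = (safePair X Y Z).swap := by
  simp only [safePair, prefPair_eq, Prod.swap_prod_mk, Prod.mk.injEq, isDeriv_swap_iff (X := Y)]
  constructor <;> simp only [and_comm]

theorem safePair_fst_mem {X Y Z : List α} (h : (safePair X Y Z).1 ≤ X.length) :
    ∃ T, IsDeriv X Y Z T ∧ prefLen X T = (safePair X Y Z).1 ∧ prefLen Y T = prefLen Y Z := by
  have hmem : (safePair X Y Z).1 ∈ {i | ∃ T, IsDeriv X Y Z T ∧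
      prefPair X Y T = (i, (prefPair X Y Z).2)} ∪ {X.length + 1} :=
    Nat.sInf_mem ⟨X.length + 1, Or.inr rfl⟩
  rcases hmem with ⟨T, hT, heq⟩ | heq
  · rw [prefPair_eq, Prod.mk.injEq] at heq
    exact ⟨T, hT, heq⟩
  · rw [Set.mem_singleton_iff] at heq
    omega

theorem safePair_fst_le {X Y Z T : List α} (h : IsDeriv X Y Z T)
    (hY : prefLen Y T = prefLen Y Z) : (safePair X Y Z).1 ≤ prefLen X T :=
  Nat.sInf_le (Or.inl ⟨T, h, by rw [prefPair_eq, hY, prefPair_eq]⟩)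

theorem safePair_fst_le_succ_length (X Y Z : List α) :
    (safePair X Y Z).1 ≤ X.length + 1 :=
  Nat.sInf_le (Or.inr rfl)

theorem safePair_concat_fst {X Y Z : List α} {c : α} (hc : Extensible X Y Z c) :
    (safePair X Y (Z ++ [c])).1 =
      sInf (({X.length + 1} : Set ℕ) ∪
        {m | ∃ j cj, (prefPair X Y Z).2 < j ∧ j < (prefPair X Y (Z ++ [c])).2 ∧
          Y[j - 1]? = some cj ∧
          nextIdx X cj (prefPair X Y Z).1 ≤ X.length ∧
          m = nextIdx X c (nextIdx X cj (prefPair X Y Z).1)} ∪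
        {m | (safePair X Y Z).1 ≤ X.length ∧
          m = nextIdx X c (safePair X Y Z).1}) := by
  have hZc : Shares X Y (Z ++ [c]) := IsMCSPrefix.shares hc
  have hZX : Z.Sublist X := (List.sublist_append_left _ _).trans hZc.1
  have hZY : Z.Sublist Y := (List.sublist_append_left _ _).trans hZc.2
  have hYc := prefLen_concat hZc.2
  have hYle : nextIdx Y c (prefLen Y Z) ≤ Y.length := (concat_sublist_iff hZY).1 hZc.2
  simp only [prefPair_eq]
  apply le_antisymm
  · have hle : ∀ {T : List α} {m : ℕ}, Shares X Y T →
        (nextIdx X c (prefLen X T) ≤ X.length → Shares X Y (T ++ [c]) →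
          IsDeriv X Y (Z ++ [c]) (T ++ [c])) → prefLen Y Z ≤ prefLen Y T →
        prefLen Y T < nextIdx Y c (prefLen Y Z) → m = nextIdx X c (prefLen X T) →
        (safePair X Y (Z ++ [c])).1 ≤ m := by
      rintro T m hT hder h₁ h₂ rfl
      by_cases hX : nextIdx X c (prefLen X T) ≤ X.length
      · have heq := nextIdx_eq_of_le_of_lt h₁ h₂ hYle
        have hTc : Shares X Y (T ++ [c]) :=
          ⟨(concat_sublist_iff hT.1).2 hX, (concat_sublist_iff hT.2).2 (heq ▸ hYle)⟩
        rw [← prefLen_concat hTc.1]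
        exact safePair_fst_le (hder hX hTc) (by rw [prefLen_concat hTc.2, heq, hYc])
      · have := safePair_fst_le_succ_length X Y (Z ++ [c])
        omega
    refine le_csInf ⟨X.length + 1, Or.inl (Or.inl rfl)⟩ ?_
    rintro m ((rfl | ⟨j, d, hj₁, hj₂, hjd, hdX, hm⟩) | ⟨hs, hm⟩)
    · exact safePair_fst_le_succ_length _ _ _
    · rw [hYc] at hj₂
      have hjY : j ≤ Y.length := by omega
      have hdY : nextIdx Y d (prefLen Y Z) ≤ j := (nextIdx_le_iff hjY).2 ⟨j, hj₁, le_rfl, hjd⟩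
      have hZd : Shares X Y (Z ++ [d]) :=
        ⟨(concat_sublist_iff hZX).2 hdX, (concat_sublist_iff hZY).2 (hdY.trans hjY)⟩
      refine hle hZd (fun _ hs => ⟨Z.length, by simp, d, by simp, hs⟩)
        (prefLen_mono (List.sublist_append_left _ _) hZd.2) ?_ ?_
      · rw [prefLen_concat hZd.2]
        omega
      · rw [hm, prefLen_concat hZd.1]
    · obtain ⟨T, hT, hTX, hTY⟩ := safePair_fst_mem hs
      refine hle hT.shares (fun _ => hT.concat) hTY.ge ?_ (by rw [hm, hTX])
      rw [hTY]
      exact (nextIdx_spec hYle).1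
  · refine csInf_le_csInf_of_forall_exists_le ⟨X.length + 1, Or.inr rfl⟩ ?_
    rintro m (⟨T, hT, heq⟩ | rfl)
    swap
    · exact ⟨X.length + 1, Or.inl (Or.inl rfl), le_rfl⟩
    obtain ⟨rfl, hTY⟩ := Prod.mk.inj heq
    change prefLen Y T = prefLen Y (Z ++ [c]) at hTY
    change ∃ a ∈ _, a ≤ prefLen X T
    have hTs := hT.shares
    rcases hT.concat_cases with ⟨d, rfl⟩ | ⟨d, rfl⟩ | ⟨S, z, hS, rfl⟩
    · have h₁ := (nextIdx_spec ((concat_sublist_iff hZc.2).1 hTs.2)).1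
      rw [prefLen_concat hTs.2] at hTY
      omega
    · have hZd : Shares X Y (Z ++ [d]) :=
        ⟨(List.sublist_append_left _ _).trans hTs.1, (List.sublist_append_left _ _).trans hTs.2⟩
      have hdX := (concat_sublist_iff hZX).1 hZd.1
      have hdY := nextIdx_spec ((concat_sublist_iff hZY).1 hZd.2)
      have hcY := (nextIdx_spec ((concat_sublist_iff hZd.2).1 hTs.2)).1
      rw [← prefLen_concat hTs.2, hTY, prefLen_concat hZd.2] at hcY
      refine ⟨_, Or.inl (Or.inr ⟨_, d, hdY.1, hcY, hdY.2, hdX, rfl⟩), ?_⟩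
      rw [prefLen_concat hTs.1, prefLen_concat hZd.1]
    · have hSs := hS.shares
      have hmX := prefLen_mono hS.sublist hSs.1
      have hmY := prefLen_mono hS.sublist hSs.2
      rcases hmY.eq_or_lt with hY | hY
      · have hsafe := safePair_fst_le hS hY.symm
        exact ⟨_, Or.inr ⟨hsafe.trans (prefLen_le_length hSs.1), rfl⟩,
          (nextIdx_mono X c hsafe).trans (prefLen_concat hTs.1).ge⟩
      rcases hmX.eq_or_lt with hX | hX
      · refine absurd hTY (hT.prefLen_ne hc ?_)
        rw [prefLen_concat hTs.1, ← hX, prefLen_concat hZc.1]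
      have last_eq : ∀ {W : List α}, (S ++ [z]).Sublist W →
          W[prefLen W (S ++ [z]) - 1]? = some z := fun {W} hW => by
        rw [prefLen_concat hW]
        exact (nextIdx_spec ((concat_sublist_iff
          ((List.sublist_append_left _ _).trans hW)).1 hW)).2
      have hzX : nextIdx X z (prefLen X Z) ≤ prefLen X (S ++ [z]) :=
        Nat.sInf_le (Or.inl ⟨hX, last_eq hSs.1⟩)
      have hcY := (nextIdx_spec ((concat_sublist_iff hSs.2).1 hTs.2)).1
      rw [← prefLen_concat hTs.2, hTY] at hcY
      exact ⟨_, Or.inl (Or.inr ⟨_, z, hY, hcY, last_eq hSs.2,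
        hzX.trans (prefLen_le_length hSs.1), rfl⟩),
        (nextIdx_mono X c hzX).trans (prefLen_concat hTs.1).ge⟩

theorem statement7 (X Y : List ℕ) (σ : ℕ) (hsen : Sentinel X Y σ)
    (Z' : List ℕ) (hZ' : Z' ≠ []) (hpre : IsMCSPrefix X Y Z') (c : ℕ)
    (hc : Extensible X Y Z' c) :
    (safePair X Y (Z' ++ [c])).1 =
      sInf (({X.length + 1} : Set ℕ) ∪
        {m | ∃ j cj, (prefPair X Y Z').2 < j ∧ j < (prefPair X Y (Z' ++ [c])).2 ∧
          Y[j - 1]? = some cj ∧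
          nextIdx X cj (prefPair X Y Z').1 ≤ X.length ∧
          m = nextIdx X c (nextIdx X cj (prefPair X Y Z').1)} ∪
        {m | (safePair X Y Z').1 ≤ X.length ∧
          m = nextIdx X c (safePair X Y Z').1}) ∧
    (safePair X Y (Z' ++ [c])).2 =
      sInf (({Y.length + 1} : Set ℕ) ∪
        {m | ∃ i ci, (prefPair X Y Z').1 < i ∧ i < (prefPair X Y (Z' ++ [c])).1 ∧
          X[i - 1]? = some ci ∧
          nextIdx Y ci (prefPair X Y Z').2 ≤ Y.length ∧
          m = nextIdx Y c (nextIdx Y ci (prefPair X Y Z').2)} ∪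
        {m | (safePair X Y Z').2 ≤ Y.length ∧
          m = nextIdx Y c (safePair X Y Z').2}) := by
  refine ⟨safePair_concat_fst hc, ?_⟩
  have h := safePair_concat_fst (IsMCSPrefix.swap hc : Extensible Y X Z' c)
  simp only [safePair_swap X Y, prefPair_swap X Y, Prod.fst_swap, Prod.snd_swap] at h
  exact h

end MCSPaper
end

section
/- Under the sentinel assumptions, for any nonempty MCS-prefix Z' and any character c, the character c is Z'-extensible if and only if there exists a prominent c-witness of Z'-extensibility; in particular, there exists a c-witness of Z'-extensibility if and only if there exists a prominent c-witness of Z'-extensibility. -/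
open scoped Classical

namespace MCSPaper

variable {α : Type*}

/-- The least length of a prefix of `W` containing `Z` as a subsequence. -/
noncomputable def prefIdx (W Z : List α) : ℕ := sInf {i | Z.Sublist (W.take i)}

/-- The greatest (1-based) start of a suffix of `W` containing `Z` as a subsequence. -/
noncomputable def suffIdx (W Z : List α) : ℕ :=
  sSup {i | i ≤ W.length + 1 ∧ Z.Sublist (W.drop (i - 1))}

section Index

variable {W A B : List α}

theorem prefIdx_le {n : ℕ} (h : A.Sublist (W.take n)) : prefIdx W A ≤ n := Nat.sInf_le h

theorem sublist_take_prefIdx (h : A.Sublist W) : A.Sublist (W.take (prefIdx W A)) :=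
  Nat.sInf_mem (s := {i | A.Sublist (W.take i)}) ⟨W.length, by simpa using h⟩

theorem bddAbove_suffIdx (W A : List α) :
    BddAbove {i | i ≤ W.length + 1 ∧ A.Sublist (W.drop (i - 1))} :=
  ⟨W.length + 1, fun _ h => h.1⟩

theorem le_suffIdx {n : ℕ} (hn : n ≤ W.length + 1) (h : A.Sublist (W.drop (n - 1))) :
    n ≤ suffIdx W A :=
  le_csSup (bddAbove_suffIdx W A) ⟨hn, h⟩

theorem suffIdx_mem (h : A.Sublist W) :
    suffIdx W A ≤ W.length + 1 ∧ A.Sublist (W.drop (suffIdx W A - 1)) :=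
  Nat.sSup_mem (s := {i | i ≤ W.length + 1 ∧ A.Sublist (W.drop (i - 1))})
    ⟨0, by simpa using h⟩ (bddAbove_suffIdx W A)

theorem prefIdx_mono (hAB : A.Sublist B) (hB : B.Sublist W) : prefIdx W A ≤ prefIdx W B :=
  prefIdx_le (hAB.trans (sublist_take_prefIdx hB))

theorem suffIdx_anti (hAB : A.Sublist B) (hB : B.Sublist W) : suffIdx W B ≤ suffIdx W A :=
  le_suffIdx (suffIdx_mem hB).1 (hAB.trans (suffIdx_mem hB).2)

theorem append_sublist_of_prefIdx_lt (hA : A.Sublist W) (hB : B.Sublist W)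
    (h : prefIdx W A < suffIdx W B) : (A ++ B).Sublist W := by
  have h1 : (W.drop (suffIdx W B - 1)).Sublist (W.drop (prefIdx W A)) :=
    List.drop_sublist_drop_left W (by omega)
  have h2 := (sublist_take_prefIdx hA).append ((suffIdx_mem hB).2.trans h1)
  rwa [List.take_append_drop] at h2

theorem prefIdx_lt_of_append_sublist (h : (A ++ B).Sublist W) :
    prefIdx W A < suffIdx W B := by
  obtain ⟨W₁, W₂, rfl, hA, hB⟩ := List.append_sublist_iff.1 h
  have h1 : prefIdx (W₁ ++ W₂) A ≤ W₁.length := prefIdx_le (by simpa using hA)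
  have h2 : W₁.length + 1 ≤ suffIdx (W₁ ++ W₂) B := le_suffIdx (by simp) (by simpa using hB)
  omega

theorem getElem?_suffIdx {d : α} (h : (d :: A).Sublist W) :
    1 ≤ suffIdx W (d :: A) ∧ suffIdx W (d :: A) ≤ W.length ∧
      W[suffIdx W (d :: A) - 1]? = some d := by
  obtain ⟨-, h2⟩ := suffIdx_mem h
  have h0 : 1 ≤ suffIdx W (d :: A) := le_suffIdx (by omega) (by simpa using h)
  have hlt : suffIdx W (d :: A) - 1 < W.length := by
    have := h2.length_le
    simp only [List.length_cons, List.length_drop] at this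
    omega
  refine ⟨h0, by omega, ?_⟩
  rw [List.drop_eq_getElem_cons hlt, List.cons_sublist_cons'] at h2
  rcases h2 with h2 | h2
  · have := le_suffIdx (n := suffIdx W (d :: A) + 1) (by omega)
      (h2.trans (List.drop_sublist_drop_left W (by omega)))
    omega
  · exact (List.getElem?_eq_getElem hlt).trans (congrArg some h2.1.symm)

theorem getElem?_prefIdx {d : α} (h : (A ++ [d]).Sublist W) :
    1 ≤ prefIdx W (A ++ [d]) ∧ prefIdx W (A ++ [d]) ≤ W.length ∧
      W[prefIdx W (A ++ [d]) - 1]? = some d := by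
  have h2 := sublist_take_prefIdx h
  have hle : prefIdx W (A ++ [d]) ≤ W.length := prefIdx_le (by simpa using h)
  have h0 : 1 ≤ prefIdx W (A ++ [d]) := by
    have := h2.length_le
    simp only [List.length_append, List.length_singleton, List.length_take] at this
    omega
  refine ⟨h0, hle, ?_⟩
  have hlt : prefIdx W (A ++ [d]) - 1 < W.length := by omega
  have hmin : ¬ (A ++ [d]).Sublist (W.take (prefIdx W (A ++ [d]) - 1)) := fun h' => by
    have := prefIdx_le h'
    omega
  have heq : W.take (prefIdx W (A ++ [d])) =
      W.take (prefIdx W (A ++ [d]) - 1) ++ [W[prefIdx W (A ++ [d]) - 1]] := by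
    rw [List.take_append_getElem]
    congr 1
    omega
  rw [heq, ← List.reverse_sublist, List.reverse_append, List.reverse_append] at h2
  rw [← List.reverse_sublist, List.reverse_append] at hmin
  simp only [List.reverse_singleton, List.singleton_append, List.cons_sublist_cons'] at h2 hmin
  rcases h2 with h2 | h2
  · exact absurd h2 hmin
  · exact (List.getElem?_eq_getElem hlt).trans (congrArg some h2.1.symm)

theorem append_singleton_sublist_take {d : α} {n : ℕ} (hA : A.Sublist W)
    (h : prefIdx W A < n) (hd : W[n - 1]? = some d) : (A ++ [d]).Sublist (W.take n) := by
  obtain ⟨hlt, hd⟩ := List.getElem?_eq_some_iff.1 hd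
  have heq : W.take n = W.take (n - 1) ++ [W[n - 1]] := by
    rw [List.take_append_getElem]
    congr 1
    omega
  rw [heq, hd]
  exact ((sublist_take_prefIdx hA).trans
    (List.take_sublist_take_left (by omega))).append (List.Sublist.refl _)

end Index

section Pairs

variable {X Y A B : List α}

theorem Shares.append_iff (hA : Shares X Y A) (hB : Shares X Y B) :
    Shares X Y (A ++ B) ↔ pLt (prefPair X Y A) (suffPair X Y B) :=
  ⟨fun h => ⟨prefIdx_lt_of_append_sublist h.1, prefIdx_lt_of_append_sublist h.2⟩,
    fun h => ⟨append_sublist_of_prefIdx_lt hA.1 hB.1 h.1,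
      append_sublist_of_prefIdx_lt hA.2 hB.2 h.2⟩⟩

theorem Shares.left (h : Shares X Y (A ++ B)) : Shares X Y A :=
  ⟨(List.sublist_append_left A B).trans h.1, (List.sublist_append_left A B).trans h.2⟩

theorem Shares.right (h : Shares X Y (A ++ B)) : Shares X Y B :=
  ⟨(List.sublist_append_right A B).trans h.1, (List.sublist_append_right A B).trans h.2⟩

theorem IsDeriv.sublist_s10 (h : IsDeriv X Y A B) : A.Sublist B := by
  obtain ⟨k, -, c, rfl, -⟩ := h
  conv_lhs => rw [← List.take_append_drop k A]
  exact (List.Sublist.refl _).append (List.sublist_cons_self _ _)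

theorem IsDeriv.length_eq (h : IsDeriv X Y A B) : B.length = A.length + 1 := by
  obtain ⟨k, hk, c, rfl, -⟩ := h
  simp only [List.length_append, List.length_take, List.length_cons, List.length_drop]
  omega

theorem IsDeriv.shares_s10 (h : IsDeriv X Y A B) : Shares X Y B := by
  obtain ⟨k, -, c, rfl, h⟩ := h
  exact h

theorem isDeriv_append_singleton {d : α} (h : Shares X Y (A ++ [d])) :
    IsDeriv X Y A (A ++ [d]) :=
  ⟨A.length, le_rfl, d, by simp, h⟩

/-- A common subsequence `A ++ B` is maximal iff no derivative of `A` or of `B` can replace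
it. -/
theorem isMCS_append_iff : IsMCS X Y (A ++ B) ↔ Shares X Y (A ++ B) ∧
    (∀ A', IsDeriv X Y A A' → ¬ Shares X Y (A' ++ B)) ∧
    (∀ B', IsDeriv X Y B B' → ¬ Shares X Y (A ++ B')) := by
  constructor
  · rintro ⟨hs, hm⟩
    refine ⟨hs, ?_, ?_⟩
    · rintro _ ⟨k, hk, c, rfl, -⟩ h
      refine hm k (by simp; omega) c ?_
      rw [List.take_append_of_le_length hk, List.drop_append_of_le_length hk]
      simpa using h
    · rintro _ ⟨k, hk, c, rfl, -⟩ h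
      refine hm (A.length + k) (by simp; omega) c ?_
      simpa [List.take_length_add_append, List.drop_length_add_append] using h
  · rintro ⟨hs, hA, hB⟩
    refine ⟨hs, fun k hk c h => ?_⟩
    rcases le_total k A.length with hkA | hkA
    · rw [List.take_append_of_le_length hkA, List.drop_append_of_le_length hkA] at h
      have h : Shares X Y ((A.take k ++ c :: A.drop k) ++ B) := by simpa using h
      exact hA _ ⟨k, hkA, c, rfl, h.left⟩ h
    · obtain ⟨m, rfl⟩ := Nat.exists_eq_add_of_le hkA
      have h : Shares X Y (A ++ (B.take m ++ c :: B.drop m)) := by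
        simpa [List.take_length_add_append, List.drop_length_add_append] using h
      exact hB _ ⟨m, by simpa using hk, c, rfl, h.right⟩ h

theorem Shares.isMatch_prefPair (h : Shares X Y A) (hA : A ≠ []) :
    IsMatch X Y (prefPair X Y A) := by
  obtain ⟨A, d, rfl⟩ := (List.eq_nil_or_concat' A).resolve_left hA
  obtain ⟨h1, h2, h3⟩ := getElem?_prefIdx h.1
  obtain ⟨h4, h5, h6⟩ := getElem?_prefIdx h.2
  exact ⟨h1, h2, h4, h5, d, h3, h6⟩

theorem Shares.matchChar_suffPair {d : α} (h : Shares X Y (d :: A)) :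
    MatchChar X Y (suffPair X Y (d :: A)) d :=
  ⟨(getElem?_suffIdx h.1).2.2, (getElem?_suffIdx h.2).2.2⟩

theorem Shares.isMatch_suffPair {d : α} (h : Shares X Y (d :: A)) :
    IsMatch X Y (suffPair X Y (d :: A)) :=
  ⟨(getElem?_suffIdx h.1).1, (getElem?_suffIdx h.1).2.1, (getElem?_suffIdx h.2).1,
    (getElem?_suffIdx h.2).2.1, d, h.matchChar_suffPair⟩

theorem IsDeriv.prefPair_le (h : IsDeriv X Y A B) : pLe (prefPair X Y A) (prefPair X Y B) :=
  ⟨prefIdx_mono h.sublist_s10 h.shares_s10.1, prefIdx_mono h.sublist_s10 h.shares_s10.2⟩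

theorem IsDeriv.suffPair_le (h : IsDeriv X Y A B) : pLe (suffPair X Y B) (suffPair X Y A) :=
  ⟨suffIdx_anti h.sublist_s10 h.shares_s10.1, suffIdx_anti h.sublist_s10 h.shares_s10.2⟩

/-- Every witness `v` can be appended without creating room for insertions into `Z'`: no
derivative of `Z'` ends strictly before `v`. -/
theorem IsDeriv.not_prefPair_lt {Z' Zs : List α} {v : ℕ × ℕ} (hd : IsDeriv X Y Z' Zs)
    (hv : pPrec X Y (prefPair X Y Z') v) (hs : pLe v (safePair X Y Z')) :
    ¬ pLt (prefPair X Y Zs) v := by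
  rintro ⟨h1, h2⟩
  obtain ⟨hle1, hle2⟩ := hd.prefPair_le
  have hne : Zs ≠ [] := List.ne_nil_of_length_pos (by rw [hd.length_eq]; omega)
  rcases hle1.eq_or_lt with heq | hlt1
  · have : (safePair X Y Z').2 ≤ (prefPair X Y Zs).2 :=
      Nat.sInf_le (Or.inl ⟨Zs, hd, by rw [heq]⟩)
    have := hs.2
    omega
  rcases hle2.eq_or_lt with heq | hlt2
  · have : (safePair X Y Z').1 ≤ (prefPair X Y Zs).1 :=
      Nat.sInf_le (Or.inl ⟨Zs, hd, by rw [heq]⟩)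
    have := hs.1
    omega
  exact hv.2 ⟨_, hd.shares_s10.isMatch_prefPair hne, ⟨hlt1, hlt2⟩, h1, h2⟩

/-- If `Z' ++ c :: R` is maximal, then `suff(c :: R)` is a `c`-witness. -/
theorem IsMCS.isCWitness {Z' R : List α} {c : α} (hM : IsMCS X Y (Z' ++ c :: R)) :
    IsCWitness X Y Z' c (suffPair X Y (c :: R)) := by
  obtain ⟨hs, hm, -⟩ := isMCS_append_iff.1 hM
  have hR := hs.right
  have hlt := (hs.left.append_iff hR).1 hs
  obtain ⟨-, hvX, -, hvY, -⟩ := hR.isMatch_suffPair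
  refine ⟨⟨c :: R, by simp, hR, rfl⟩, ⟨hlt, ?_⟩, ⟨?_, ?_⟩, hR.matchChar_suffPair⟩
  · rintro ⟨w, ⟨-, -, -, -, d, hd1, hd2⟩, hw1, hw2⟩
    have h1 := append_singleton_sublist_take hs.left.1 hw1.1 hd1
    have h2 := append_singleton_sublist_take hs.left.2 hw1.2 hd2
    have hd : Shares X Y (Z' ++ [d]) :=
      ⟨h1.trans (List.take_sublist _ _), h2.trans (List.take_sublist _ _)⟩
    exact hm _ (isDeriv_append_singleton hd) ((hd.append_iff hR).2
      ⟨(prefIdx_le h1).trans_lt hw2.1, (prefIdx_le h2).trans_lt hw2.2⟩)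
  · refine le_csInf ⟨_, Or.inr rfl⟩ ?_
    rintro b (⟨Zs, hd, hp⟩ | rfl)
    · by_contra! hb
      refine hm Zs hd ((hd.shares_s10.append_iff hR).2 ?_)
      rw [hp]
      exact ⟨hb, hlt.2⟩
    · omega
  · refine le_csInf ⟨_, Or.inr rfl⟩ ?_
    rintro b (⟨Zs, hd, hp⟩ | rfl)
    · by_contra! hb
      refine hm Zs hd ((hd.shares_s10.append_iff hR).2 ?_)
      rw [hp]
      exact ⟨hlt.1, hb⟩
    · omega

theorem Extensible.exists_isCWitness {Z' : List α} {c : α} (h : Extensible X Y Z' c) :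
    ∃ v, IsCWitness X Y Z' c v := by
  obtain ⟨_, hM, R, rfl⟩ := h
  rw [List.append_assoc, List.singleton_append] at hM
  exact ⟨_, hM.isCWitness⟩

/-- Two witnesses comparable for `⪇` have the same character. -/
theorem IsCWitness.of_pLe {Z' : List α} {c : α} {v v' : ℕ × ℕ} (hv : IsCWitness X Y Z' c v)
    (hv' : IsWitness X Y Z' v') (hle : pLe v' v) : IsCWitness X Y Z' c v' := by
  obtain ⟨d, hs, hp, hsafe, hd⟩ := hv'
  suffices hcd : d = c by
    subst hcd
    exact ⟨hs, hp, hsafe, hd⟩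
  obtain ⟨Z, hZ, hsZ, rfl⟩ := hs
  obtain ⟨e, R, rfl⟩ := List.exists_cons_of_ne_nil hZ
  have hc := hv.2.2.2
  rcases hle.1.eq_or_lt with heq | hlt1
  · have h1 := hd.1
    rw [heq, hc.1] at h1
    exact (Option.some.inj h1).symm
  rcases hle.2.eq_or_lt with heq | hlt2
  · have h1 := hd.2
    rw [heq, hc.2] at h1
    exact (Option.some.inj h1).symm
  exact absurd ⟨_, hsZ.isMatch_suffPair, hp.1, hlt1, hlt2⟩ hv.2.1.2

theorem IsCWitness.exists_prominent {Z' : List α} {c : α} {v : ℕ × ℕ}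
    (hv : IsCWitness X Y Z' c v) : ∃ v, IsCWitness X Y Z' c v ∧ Prominent X Y Z' v := by
  obtain ⟨u, hu, hmin⟩ := exists_minimalFor_of_wellFoundedLT (IsCWitness X Y Z' c)
    (fun v => v.1 + v.2) ⟨v, hv⟩
  refine ⟨u, hu, ⟨c, hu⟩, ?_⟩
  rintro ⟨u', hu', hle, hne⟩
  have h := hmin (hu.of_pLe hu' hle) (by have := hle.1; have := hle.2; dsimp only; omega)
  dsimp only at h
  have h1 := hle.1
  have h2 := hle.2
  exact hne (Prod.ext (by omega) (by omega))

theorem Prominent.extensible {Z' : List α} {c : α} {v : ℕ × ℕ} (hZ' : Shares X Y Z')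
    (hp : Prominent X Y Z' v) (hv : IsCWitness X Y Z' c v) : Extensible X Y Z' c := by
  obtain ⟨hsuff, hprec, hsafe, hc⟩ := hv
  obtain ⟨Z, ⟨hZ, hsZ, hZv⟩, hmax⟩ : ∃ Z : List α, (Z ≠ [] ∧ Shares X Y Z ∧ suffPair X Y Z = v) ∧
      ∀ B, (B ≠ [] ∧ Shares X Y B ∧ suffPair X Y B = v) → B.length ≤ Z.length := by
    obtain ⟨Z, hZ, hmin⟩ := exists_minimalFor_of_wellFoundedLT
      (fun Z : List α => Z ≠ [] ∧ Shares X Y Z ∧ suffPair X Y Z = v)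
      (fun Z => X.length - Z.length) hsuff
    refine ⟨Z, hZ, fun B hB => ?_⟩
    by_contra! hlt
    have h := hmin hB (by dsimp only; omega)
    dsimp only at h
    have := hB.2.1.1.length_le
    omega
  obtain ⟨e, R, rfl⟩ := List.exists_cons_of_ne_nil hZ
  obtain rfl : e = c := by
    have h1 := hsZ.matchChar_suffPair.1
    rw [hZv, hc.1] at h1
    exact (Option.some.inj h1).symm
  suffices hM : IsMCS X Y (Z' ++ e :: R) from ⟨_, hM, R, by simp⟩
  refine isMCS_append_iff.2 ⟨(hZ'.append_iff hsZ).2 (hZv ▸ hprec.1), ?_, ?_⟩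
  · intro A' hA' h
    exact hA'.not_prefPair_lt hprec hsafe (hZv ▸ (hA'.shares_s10.append_iff hsZ).1 h)
  · intro B' hB' h
    have hlt := (hZ'.append_iff hB'.shares_s10).1 h
    have hle := hB'.suffPair_le
    have hlen := hB'.length_eq
    have hsB := hB'.shares_s10
    rw [hZv] at hle
    have hne : B' ≠ [] := List.ne_nil_of_length_pos (by omega)
    obtain ⟨d, S, rfl⟩ := List.exists_cons_of_ne_nil hne
    have hw : IsWitness X Y Z' (suffPair X Y (d :: S)) := by
      refine ⟨d, ⟨_, hne, hsB, rfl⟩, ⟨hlt, ?_⟩,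
        ⟨hle.1.trans hsafe.1, hle.2.trans hsafe.2⟩, hsB.matchChar_suffPair⟩
      rintro ⟨w, hw, hw1, hw2⟩
      exact hprec.2 ⟨w, hw, hw1, hw2.1.trans_le hle.1, hw2.2.trans_le hle.2⟩
    have heq : suffPair X Y (d :: S) = v := by
      by_contra hne'
      exact hp.2 ⟨_, hw, hle, hne'⟩
    have := hmax _ ⟨hne, hsB, heq⟩
    omega

end Pairs

theorem statement10 (X Y : List ℕ) (σ : ℕ) (hsen : Sentinel X Y σ)
    (Z' : List ℕ) (hZ' : Z' ≠ []) (hpre : IsMCSPrefix X Y Z') (c : ℕ) :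
    (Extensible X Y Z' c ↔
      ∃ v, IsCWitness X Y Z' c v ∧ Prominent X Y Z' v) ∧
    ((∃ v, IsCWitness X Y Z' c v) ↔
      ∃ v, IsCWitness X Y Z' c v ∧ Prominent X Y Z' v) := by
  obtain ⟨_, hM, _, rfl⟩ := hpre
  have hext : (∃ v, IsCWitness X Y Z' c v ∧ Prominent X Y Z' v) → Extensible X Y Z' c :=
    fun ⟨_, hv, hp⟩ => hp.extensible hM.1.left hv
  have hprom : (∃ v, IsCWitness X Y Z' c v) →
      ∃ v, IsCWitness X Y Z' c v ∧ Prominent X Y Z' v :=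
    fun ⟨_, hv⟩ => hv.exists_prominent
  exact ⟨⟨fun h => hprom h.exists_isCWitness, hext⟩, hprom, fun ⟨v, hv, _⟩ => ⟨v, hv⟩⟩

end MCSPaper
end

section
/- Under the sentinel assumptions, for any nonempty MCS-prefix Z' and any suff-match v with pref(Z') < v and v ≤ safe(Z'), the match v is a prominent witness of Z'-extensibility if and only if there is no suff-match v' with pref(Z') < v' and v' ⪇ v. -/
open scoped Classical

namespace MCSPaper

variable {α : Type*}

theorem le_suffIdx_s13 {W Z : List α} {i : ℕ} (hi : i ≤ W.length + 1)
    (hZ : Z.Sublist (W.drop (i - 1))) : i ≤ suffIdx W Z :=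
  le_csSup ⟨W.length + 1, fun _ h => h.1⟩ ⟨hi, hZ⟩

theorem one_le_suffIdx {W Z : List α} (hZ : Z.Sublist W) : 1 ≤ suffIdx W Z :=
  le_suffIdx_s13 (by omega) (by simpa using hZ)

theorem suffIdx_mem_s13 {W Z : List α} (hZ : Z.Sublist W) :
    suffIdx W Z ≤ W.length + 1 ∧ Z.Sublist (W.drop (suffIdx W Z - 1)) :=
  Nat.sSup_mem (s := {i | i ≤ W.length + 1 ∧ Z.Sublist (W.drop (i - 1))})
    ⟨1, by omega, by simpa using hZ⟩ ⟨W.length + 1, fun _ h => h.1⟩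

theorem suffIdx_cons_lt {W Z : List α} {c : α} (hZ : (c :: Z).Sublist W) :
    suffIdx W (c :: Z) - 1 < W.length := by
  by_contra! h
  have h2 := (suffIdx_mem_s13 hZ).2
  rw [List.drop_eq_nil_of_le h] at h2
  simp at h2

theorem getElem?_suffIdx_cons {W Z : List α} {c : α} (hZ : (c :: Z).Sublist W) :
    W[suffIdx W (c :: Z) - 1]? = some c := by
  have hlt := suffIdx_cons_lt hZ
  have h1 := one_le_suffIdx hZ
  have h2 := (suffIdx_mem_s13 hZ).2
  rw [List.drop_eq_getElem_cons hlt, List.cons_sublist_cons'] at h2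
  rcases h2 with h | h
  · have := le_suffIdx_s13 (W := W) (Z := c :: Z) (i := suffIdx W (c :: Z) + 1) (by omega)
      (by rwa [show suffIdx W (c :: Z) + 1 - 1 = suffIdx W (c :: Z) - 1 + 1 by omega])
    omega
  · exact (List.getElem?_eq_getElem hlt).trans (congrArg some h.1.symm)

theorem suffIdx_cons_lt_suffIdx {W Z : List α} {c : α} (hZ : (c :: Z).Sublist W) :
    suffIdx W (c :: Z) < suffIdx W Z := by
  have hlt := suffIdx_cons_lt hZ
  have h1 := one_le_suffIdx hZ
  have h2 := (suffIdx_mem_s13 hZ).2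
  rw [List.drop_eq_getElem_cons hlt] at h2
  have h3 := h2.tail
  simp only [List.tail_cons] at h3
  refine le_suffIdx_s13 (by omega) ?_
  rwa [show (suffIdx W (c :: Z)).succ - 1 = suffIdx W (c :: Z) - 1 + 1 by omega]

theorem cons_sublist_drop {W Z : List α} {c : α} {i : ℕ} (hZ : Z.Sublist W) (h1 : 1 ≤ i)
    (hc : W[i - 1]? = some c) (hi : i < suffIdx W Z) :
    (c :: Z).Sublist (W.drop (i - 1)) := by
  obtain ⟨hlt, rfl⟩ := List.getElem?_eq_some_iff.1 hc
  rw [List.drop_eq_getElem_cons hlt]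
  exact ((suffIdx_mem_s13 hZ).2.trans (List.drop_sublist_drop_left W (by omega))).cons_cons _

theorem IsSuffMatch.exists_matchChar {X Y : List α} {v : ℕ × ℕ} (hv : IsSuffMatch X Y v) :
    ∃ c, MatchChar X Y v c := by
  obtain ⟨_ | ⟨c, Z⟩, hne, ⟨hX, hY⟩, rfl⟩ := hv
  · exact absurd rfl hne
  · exact ⟨c, getElem?_suffIdx_cons hX, getElem?_suffIdx_cons hY⟩

/-- Every match strictly below a suff-match `v` lies weakly below a suff-match strictly
below `v`. -/
theorem IsSuffMatch.exists_between {X Y : List α} {v w : ℕ × ℕ} (hv : IsSuffMatch X Y v)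
    (hw : IsMatch X Y w) (hwv : pLt w v) :
    ∃ v', IsSuffMatch X Y v' ∧ pLe w v' ∧ pLt v' v := by
  obtain ⟨Z, -, ⟨hX, hY⟩, rfl⟩ := hv
  obtain ⟨h1, h2, h3, h4, c, hcX, hcY⟩ := hw
  have hsX := cons_sublist_drop hX h1 hcX hwv.1
  have hsY := cons_sublist_drop hY h3 hcY hwv.2
  have hX' := hsX.trans (List.drop_sublist _ _)
  have hY' := hsY.trans (List.drop_sublist _ _)
  exact ⟨suffPair X Y (c :: Z), ⟨c :: Z, by simp, ⟨hX', hY'⟩, rfl⟩,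
    ⟨le_suffIdx_s13 (by omega) hsX, le_suffIdx_s13 (by omega) hsY⟩,
    ⟨suffIdx_cons_lt_suffIdx hX', suffIdx_cons_lt_suffIdx hY'⟩⟩

theorem statement13 (X Y : List ℕ) (σ : ℕ) (hsen : Sentinel X Y σ)
    (Z' : List ℕ) (hZ' : Z' ≠ []) (hpre : IsMCSPrefix X Y Z') (v : ℕ × ℕ)
    (hv : IsSuffMatch X Y v) (h1 : pLt (prefPair X Y Z') v)
    (h2 : pLe v (safePair X Y Z')) :
    Prominent X Y Z' v ↔
      ¬ ∃ v', IsSuffMatch X Y v' ∧ pLt (prefPair X Y Z') v' ∧ pLneq v' v := by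
  constructor
  · rintro ⟨⟨_, -, hprec, -, -⟩, hprom⟩ ⟨v', hv', hlt, hneq⟩
    obtain ⟨c, hc⟩ := hv'.exists_matchChar
    refine hprom ⟨v', ⟨c, hv', ⟨hlt, ?_⟩, ?_, hc⟩, hneq⟩
    · rintro ⟨w, hw, hw1, hw2⟩
      exact hprec.2 ⟨w, hw, hw1, hw2.1.trans_le hneq.1.1, hw2.2.trans_le hneq.1.2⟩
    · exact ⟨hneq.1.1.trans h2.1, hneq.1.2.trans h2.2⟩
  · intro hno
    obtain ⟨c, hc⟩ := hv.exists_matchChar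
    refine ⟨⟨c, hv, ⟨h1, ?_⟩, h2, hc⟩, ?_⟩
    · rintro ⟨w, hw, hw1, hw2⟩
      obtain ⟨v', hv', hle, hlt⟩ := hv.exists_between hw hw2
      refine hno ⟨v', hv', ⟨hw1.1.trans_le hle.1, hw1.2.trans_le hle.2⟩,
        ⟨hlt.1.le, hlt.2.le⟩, ?_⟩
      rintro rfl
      exact lt_irrefl _ hlt.1
    · rintro ⟨v', ⟨_, hv', hprec, -, -⟩, hneq⟩
      exact hno ⟨v', hv', hprec.1, hneq⟩

end MCSPaper
end
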